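/- arXiv:2204.08902 — 2 statements merged into one kernel-verified Lean document; each statement's English description precedes it below -/
import Mathlib

section
/- Let n ≥ 1 be a natural number, A > 0 and ℓ > 0 real numbers, and let η : ℕ → ℝ (with indices j ≥ 1) be a nondecreasing sequence satisfying the Berezin–Li–Yau inequality with parameters n and A. Let μ : ℕ → ℝ be a sequence such that for every k ≥ 1, the number of pairs of positive integers (j, l) with η(j) + π²·l²/ℓ² ≤ μ(k) is at least k. Then for every k ≥ 1, μ(k) ≥ α_{n+1} · (4π² / ω_{n+1}^{2/(n+1)}) · (k / (ℓ·A))^{2/(n+1)}. -/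
/-- The volume of the unit ball in `ℝ^m`. -/
noncomputable def unitBallVol (m : ℕ) : ℝ :=
  Real.pi ^ ((m : ℝ) / 2) / Real.Gamma ((m : ℝ) / 2 + 1)

/-- The constant `α_m` from the paper's cylinder theorem. -/
noncomputable def alphaConst (m : ℕ) : ℝ :=
  ((m : ℝ) / ((m : ℝ) + 1) ^ (1 - 1 / (m : ℝ))) * (Real.pi / 4) ^ (1 / (m : ℝ)) *
    (Real.Gamma (((m : ℝ) + 1) / 2) / Real.Gamma (((m : ℝ) + 2) / 2)) ^ (2 / (m : ℝ))

/-- `η` satisfies the Berezin–Li–Yau inequality with parameters `n` and `A`. -/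
def BerezinLiYau (n : ℕ) (A : ℝ) (η : ℕ → ℝ) : Prop :=
  ∀ k : ℕ, 1 ≤ k →
    (n / (n + 2) : ℝ) * (4 * Real.pi ^ 2) * (k : ℝ) ^ (1 + 2 / (n : ℝ))
        / (unitBallVol n * A) ^ ((2 : ℝ) / n)
      ≤ ∑ j ∈ Finset.Icc 1 k, η j

/-- The arithmetic-geometric mean inequality for `n` copies of `t / n` and one copy of `x - t`. -/
theorem pow_mul_sub_le_of_pos {n : ℕ} (hn : 1 ≤ n) {t x : ℝ} (ht : 0 < t) (hx : 0 ≤ x) :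
    t ^ n * (x - t) * ((n : ℝ) + 1) ^ (n + 1) ≤ (n : ℝ) ^ n * x ^ (n + 1) := by
  have hn0 : (0 : ℝ) < n := by exact_mod_cast hn
  obtain ⟨s, hs⟩ : ∃ s : ℝ, s = t * (n + 1) / n := ⟨_, rfl⟩
  have hs0 : 0 < s := by rw [hs]; positivity
  have hB := one_add_mul_sub_le_pow (a := x / s)
    (by have : 0 ≤ x / s := by positivity
        linarith) (n + 1)
  have hB' : s ^ n * ((n + 1) * (x - t)) ≤ x ^ (n + 1) := by
    rw [div_pow, le_div_iff₀ (by positivity)] at hB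
    refine le_of_eq_of_le ?_ hB
    have hst : t = s * n / (n + 1) := by rw [hs]; field_simp
    rw [hst]
    push_cast
    field_simp
    ring
  have hsn : s ^ n * (n : ℝ) ^ n = t ^ n * ((n : ℝ) + 1) ^ n := by
    rw [← mul_pow, ← mul_pow, hs]
    congr 1
    field_simp
  calc t ^ n * (x - t) * ((n : ℝ) + 1) ^ (n + 1)
      = (t ^ n * ((n : ℝ) + 1) ^ n) * ((n + 1) * (x - t)) := by ring
    _ = (n : ℝ) ^ n * (s ^ n * ((n + 1) * (x - t))) := by rw [← hsn]; ring
    _ ≤ _ := by gcongr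

theorem unitBallVol_pos (n : ℕ) : 0 < unitBallVol n := by
  unfold unitBallVol
  have : 0 < Real.Gamma ((n : ℝ) / 2 + 1) := Real.Gamma_pos_of_pos (by positivity)
  positivity

/-- The recursion between volumes of unit balls in consecutive dimensions. -/
theorem unitBallVol_succ_sq (n : ℕ) :
    unitBallVol (n + 1) ^ 2 = Real.pi * (Real.Gamma (((n + 1 : ℕ) + 1 : ℝ) / 2) /
      Real.Gamma (((n + 1 : ℕ) + 2 : ℝ) / 2)) ^ 2 * unitBallVol n ^ 2 := by
  unfold unitBallVol
  have e1 : ((n : ℝ) / 2 + 1) = ((n + 1 : ℕ) + 1 : ℝ) / 2 := by push_cast; ring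
  have e2 : (((n + 1 : ℕ) : ℝ) / 2 + 1) = ((n + 1 : ℕ) + 2 : ℝ) / 2 := by ring
  have g1 : 0 < Real.Gamma (((n + 1 : ℕ) + 1 : ℝ) / 2) := Real.Gamma_pos_of_pos (by positivity)
  have g2 : 0 < Real.Gamma (((n + 1 : ℕ) + 2 : ℝ) / 2) := Real.Gamma_pos_of_pos (by positivity)
  have p (m : ℕ) : (Real.pi ^ ((m : ℝ) / 2)) ^ 2 = Real.pi ^ m := by
    rw [← Real.rpow_mul_natCast Real.pi_pos.le, ← Real.rpow_natCast]
    congr 1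
    push_cast
    ring
  rw [e1, e2, div_pow, div_pow, div_pow, p, p]
  field_simp
  ring

theorem rpow_div_pow_eq_pow {x : ℝ} (hx : 0 ≤ x) {a : ℝ} {b m : ℕ} (h : a * m = b) :
    (x ^ a) ^ m = x ^ b := by
  rw [← Real.rpow_mul_natCast hx, h, Real.rpow_natCast]

/-- The number of lattice pairs below `x` is controlled by the partial sums of `η`. -/
theorem exists_sq_le_of_le_card_pairs {η : ℕ → ℝ} (hmono : Monotone η) {ℓ x : ℝ} (hℓ : 0 < ℓ)
    {k : ℕ} (hk : 1 ≤ k)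
    (hcard : k ≤ Nat.card {q : ℕ × ℕ | 1 ≤ q.1 ∧ 1 ≤ q.2 ∧
      η q.1 + Real.pi ^ 2 * (q.2 : ℝ) ^ 2 / ℓ ^ 2 ≤ x}) :
    ∃ J : ℕ, 1 ≤ J ∧
      (k : ℝ) ^ 2 ≤ (ℓ / Real.pi) ^ 2 * (J * (J * x - ∑ j ∈ Finset.Icc 1 J, η j)) := by
  set S := {q : ℕ × ℕ | 1 ≤ q.1 ∧ 1 ≤ q.2 ∧
      η q.1 + Real.pi ^ 2 * (q.2 : ℝ) ^ 2 / ℓ ^ 2 ≤ x} with hS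
  have hcard' : 0 < S.ncard := by
    rw [← Nat.card_coe_set_eq]; omega
  have hfin : S.Finite := Set.finite_of_ncard_pos hcard'
  rw [Nat.card_coe_set_eq, Set.ncard_eq_toFinset_card S hfin] at hcard
  have hT : hfin.toFinset.Nonempty := by
    rw [← Finset.card_pos]; omega
  set T := hfin.toFinset with hTdef
  have hmem (q : ℕ × ℕ) : q ∈ T ↔ 1 ≤ q.1 ∧ 1 ≤ q.2 ∧
      η q.1 + Real.pi ^ 2 * (q.2 : ℝ) ^ 2 / ℓ ^ 2 ≤ x := by
    rw [hTdef, Set.Finite.mem_toFinset, hS, Set.mem_ofPred_eq]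
  obtain ⟨p, hp, hpJ⟩ := Finset.exists_mem_eq_sup T hT Prod.fst
  have hp' := (hmem p).1 hp
  have hsub (j : ℕ) (hj : j ∈ Finset.Icc 1 p.1) : 0 ≤ x - η j := by
    have h1 := hmono (Finset.mem_Icc.1 hj).2
    have h2 : 0 ≤ Real.pi ^ 2 * (p.2 : ℝ) ^ 2 / ℓ ^ 2 := by positivity
    linarith [hp'.2.2]
  have hfiber (j : ℕ) (hj : j ∈ Finset.Icc 1 p.1) :
      ((T.filter fun q => q.1 = j).card : ℝ) ≤ ℓ / Real.pi * √(x - η j) := by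
    have hle : (T.filter fun q => q.1 = j).card ≤
        (Finset.Icc 1 ⌊ℓ / Real.pi * √(x - η j)⌋₊).card := by
      refine Finset.card_le_card_of_injOn Prod.snd ?_ ?_
      · intro q hq
        obtain ⟨hqT, rfl⟩ := Finset.mem_filter.1 (Finset.mem_coe.1 hq)
        obtain ⟨-, h2, h3⟩ := (hmem q).1 hqT
        refine Finset.mem_coe.2 (Finset.mem_Icc.2 ⟨h2, Nat.le_floor ?_⟩)
        have : Real.pi * q.2 / ℓ ≤ √(x - η q.1) := by
          apply Real.le_sqrt_of_sq_le
          rw [div_pow, mul_pow]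
          linarith
        have hpi := Real.pi_pos
        calc (q.2 : ℝ) = ℓ / Real.pi * (Real.pi * q.2 / ℓ) := by field_simp
          _ ≤ _ := by gcongr
      · intro a ha b hb hab
        have h1 := (Finset.mem_filter.1 (Finset.mem_coe.1 ha)).2
        have h2 := (Finset.mem_filter.1 (Finset.mem_coe.1 hb)).2
        exact Prod.ext (h1.trans h2.symm) hab
    rw [Nat.card_Icc, Nat.add_sub_cancel] at hle
    refine le_trans (Nat.cast_le.2 hle) (Nat.floor_le ?_)
    have hpi := Real.pi_pos
    positivity
  have hsum : (k : ℝ) ≤ ℓ / Real.pi * ∑ j ∈ Finset.Icc 1 p.1, √(x - η j) := by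
    rw [Finset.mul_sum]
    refine le_trans (Nat.cast_le.2 hcard) ?_
    rw [Finset.card_eq_sum_card_fiberwise (f := Prod.fst) (t := Finset.Icc 1 p.1)]
    · push_cast
      exact Finset.sum_le_sum hfiber
    · intro q hq
      have hq' := Finset.mem_coe.1 hq
      exact Finset.mem_coe.2 (Finset.mem_Icc.2
        ⟨((hmem q).1 hq').1, hpJ ▸ Finset.le_sup (f := Prod.fst) hq'⟩)
  refine ⟨p.1, hp'.1, ?_⟩
  have hCS := sq_sum_le_card_mul_sum_sq (s := Finset.Icc 1 p.1) (f := fun j => √(x - η j))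
  rw [Finset.sum_congr rfl fun j hj => Real.sq_sqrt (hsub j hj), Finset.sum_sub_distrib,
    Finset.sum_const, Nat.card_Icc, Nat.add_sub_cancel, nsmul_eq_mul] at hCS
  calc (k : ℝ) ^ 2 ≤ (ℓ / Real.pi * ∑ j ∈ Finset.Icc 1 p.1, √(x - η j)) ^ 2 := by gcongr
    _ = (ℓ / Real.pi) ^ 2 * (∑ j ∈ Finset.Icc 1 p.1, √(x - η j)) ^ 2 := mul_pow _ _ _
    _ ≤ _ := by gcongr

/-- The `m`-th power of the constant in the cylinder bound, without real exponents. -/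
theorem cylinder_bound_pow (n : ℕ) {y : ℝ} (hy : 0 ≤ y) :
    (alphaConst (n + 1) * (4 * Real.pi ^ 2 / unitBallVol (n + 1) ^ ((2 : ℝ) / ((n : ℝ) + 1)))
          * y ^ ((2 : ℝ) / ((n : ℝ) + 1))) ^ (n + 1) =
      ((n : ℝ) + 1) ^ (n + 1) * (4 * Real.pi ^ 2) ^ n * Real.pi ^ 2 * y ^ 2 /
        (((n : ℝ) + 2) ^ n * unitBallVol n ^ 2) := by
  have hω := unitBallVol_pos n
  have hω' := unitBallVol_pos (n + 1)
  have hpi := Real.pi_pos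
  have hsucc := unitBallVol_succ_sq n
  have g1 : 0 < Real.Gamma (((n + 1 : ℕ) + 1 : ℝ) / 2) := Real.Gamma_pos_of_pos (by positivity)
  have g2 : 0 < Real.Gamma (((n + 1 : ℕ) + 2 : ℝ) / 2) := Real.Gamma_pos_of_pos (by positivity)
  unfold alphaConst
  set G := Real.Gamma (((n + 1 : ℕ) + 1 : ℝ) / 2) / Real.Gamma (((n + 1 : ℕ) + 2 : ℝ) / 2)
  have hG : 0 < G := by positivity
  have hm : ((n : ℝ) + 1) ≠ 0 := by positivity
  simp only [mul_pow, div_pow]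
  rw [rpow_div_pow_eq_pow (b := n) (by positivity) (by push_cast; field_simp; ring),
    rpow_div_pow_eq_pow (b := 1) (by positivity) (by push_cast; field_simp),
    rpow_div_pow_eq_pow (b := 2) hG.le (by push_cast; field_simp),
    rpow_div_pow_eq_pow (b := 2) hω'.le (by push_cast; field_simp),
    rpow_div_pow_eq_pow (b := 2) hy (by push_cast; field_simp), hsucc]
  push_cast
  have e : (n : ℝ) + 1 + 1 = n + 2 := by ring
  rw [e]
  field_simp
  ring


/-- The paper's main theorem in abstract form: the improved Pólya-type lower bound for
the eigenvalues `μ k` of a cylinder `Ω × [0, ℓ] ⊂ ℝ^{n+1}` of volume `ℓ A`. -/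
theorem cylinder_eigenvalue_bound (n : ℕ) (hn : 1 ≤ n) (A ℓ : ℝ) (hA : 0 < A) (hℓ : 0 < ℓ)
    (η : ℕ → ℝ) (hmono : Monotone η) (hBLY : BerezinLiYau n A η) (μ : ℕ → ℝ)
    (hμ : ∀ k : ℕ, 1 ≤ k →
      k ≤ Nat.card {q : ℕ × ℕ | 1 ≤ q.1 ∧ 1 ≤ q.2 ∧
        η q.1 + Real.pi ^ 2 * (q.2 : ℝ) ^ 2 / ℓ ^ 2 ≤ μ k}) :
    ∀ k : ℕ, 1 ≤ k →
      alphaConst (n + 1) * (4 * Real.pi ^ 2 / unitBallVol (n + 1) ^ ((2 : ℝ) / ((n : ℝ) + 1)))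
          * ((k : ℝ) / (ℓ * A)) ^ ((2 : ℝ) / ((n : ℝ) + 1))
        ≤ μ k := by
  intro k hk
  have hω := unitBallVol_pos n
  have hpi := Real.pi_pos
  have hn0 : (0 : ℝ) < n := by exact_mod_cast hn
  have hk0 : (0 : ℝ) < k := by exact_mod_cast hk
  obtain ⟨J, hJ, hkJ⟩ := exists_sq_le_of_le_card_pairs hmono hℓ hk (hμ k hk)
  have hJ0 : (0 : ℝ) < J := by exact_mod_cast hJ
  obtain ⟨t, ht⟩ : ∃ t : ℝ, t = (n / (n + 2) : ℝ) * (4 * Real.pi ^ 2) * (J : ℝ) ^ (2 / (n : ℝ))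
      / (unitBallVol n * A) ^ ((2 : ℝ) / n) := ⟨_, rfl⟩
  have ht0 : 0 < t := by rw [ht]; positivity
  have htn : t ^ n * (((n : ℝ) + 2) ^ n * (unitBallVol n * A) ^ 2) =
      (n : ℝ) ^ n * (4 * Real.pi ^ 2) ^ n * (J : ℝ) ^ 2 := by
    rw [ht, div_pow, mul_pow, mul_pow, div_pow,
      rpow_div_pow_eq_pow (b := 2) hJ0.le (by push_cast; field_simp),
      rpow_div_pow_eq_pow (b := 2) (by positivity) (by push_cast; field_simp)]
    field_simp
  have hsum : J * t ≤ ∑ j ∈ Finset.Icc 1 J, η j := by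
    refine le_of_eq_of_le ?_ (hBLY J hJ)
    rw [Real.rpow_add hJ0, Real.rpow_one, ht]
    ring
  have hk2 : (k : ℝ) ^ 2 ≤ (ℓ / Real.pi) ^ 2 * (J ^ 2 * (μ k - t)) := by
    refine hkJ.trans ?_
    have : (J : ℝ) ^ 2 * (μ k - t) = J * (J * μ k - J * t) := by ring
    rw [this]
    gcongr
  have hμt : 0 < μ k - t := by
    have h : 0 < (ℓ / Real.pi) ^ 2 * (J ^ 2 * (μ k - t)) := lt_of_lt_of_le (by positivity) hk2
    exact pos_of_mul_pos_right (pos_of_mul_pos_right h (by positivity)) (by positivity)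
  have hμ0 : 0 ≤ μ k := by linarith
  refine le_of_pow_le_pow_left₀ (Nat.succ_ne_zero n) hμ0 ?_
  rw [Nat.succ_eq_add_one, cylinder_bound_pow n (by positivity), div_le_iff₀ (by positivity)]
  have hAG := pow_mul_sub_le_of_pos hn ht0 hμ0
  have hnn : (0 : ℝ) < (n : ℝ) ^ n := by positivity
  refine le_of_mul_le_mul_left ?_ hnn
  calc (n : ℝ) ^ n * (((n : ℝ) + 1) ^ (n + 1) * (4 * Real.pi ^ 2) ^ n * Real.pi ^ 2 *
        ((k : ℝ) / (ℓ * A)) ^ 2)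
      = (n : ℝ) ^ n * ((n : ℝ) + 1) ^ (n + 1) * (4 * Real.pi ^ 2) ^ n * Real.pi ^ 2 /
        (ℓ * A) ^ 2 * (k : ℝ) ^ 2 := by ring
    _ ≤ (n : ℝ) ^ n * ((n : ℝ) + 1) ^ (n + 1) * (4 * Real.pi ^ 2) ^ n * Real.pi ^ 2 /
        (ℓ * A) ^ 2 * ((ℓ / Real.pi) ^ 2 * (J ^ 2 * (μ k - t))) := by gcongr
    _ = ((n : ℝ) ^ n * (4 * Real.pi ^ 2) ^ n * (J : ℝ) ^ 2) *
        (((n : ℝ) + 1) ^ (n + 1) * (μ k - t)) / A ^ 2 := by field_simp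
    _ = (t ^ n * (μ k - t) * ((n : ℝ) + 1) ^ (n + 1)) *
        (((n : ℝ) + 2) ^ n * unitBallVol n ^ 2) := by
      rw [← htn]
      field_simp
    _ ≤ ((n : ℝ) ^ n * μ k ^ (n + 1)) * (((n : ℝ) + 2) ^ n * unitBallVol n ^ 2) := by gcongr
    _ = _ := by ring
end

section
/- For every natural number n ≥ 2, one has β_{n+1} < α_{n+1}, i.e., (n+1)/(n+3) < ((n+1)/(n+2)^{1 − 1/(n+1)}) · (π/4)^{1/(n+1)} · (Γ((n+2)/2) / Γ((n+3)/2))^{2/(n+1)}. -/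
/-- The Berezin–Li–Yau constant `β_m = m/(m+2)`. -/
noncomputable def betaConst (m : ℕ) : ℝ := (m : ℝ) / ((m : ℝ) + 2)

/-- A consequence of log-convexity of the Gamma function. -/
theorem Gamma_add_half_sq_le {x : ℝ} (hx : 0 < x) :
    Real.Gamma (x + 1 / 2) ^ 2 ≤ x * Real.Gamma x ^ 2 := by
  have hx1 : 0 < x + 1 := by linarith
  have h := Real.Gamma_mul_add_mul_le_rpow_Gamma_mul_rpow_Gamma hx hx1
    (a := 1 / 2) (b := 1 / 2) (by norm_num) (by norm_num) (by norm_num)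
  have hG := Real.Gamma_pos_of_pos hx
  have hG1 := Real.Gamma_pos_of_pos hx1
  rw [show 1 / 2 * x + 1 / 2 * (x + 1) = x + 1 / 2 by ring, ← Real.mul_rpow hG.le hG1.le,
    ← Real.sqrt_eq_rpow] at h
  calc Real.Gamma (x + 1 / 2) ^ 2
      ≤ √(Real.Gamma x * Real.Gamma (x + 1)) ^ 2 :=
        pow_le_pow_left₀ (Real.Gamma_pos_of_pos (by linarith)).le h 2
    _ = x * Real.Gamma x ^ 2 := by
        rw [Real.sq_sqrt (by positivity), Real.Gamma_add_one hx.ne']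
        ring

theorem alphaConst_eq {m : ℕ} (hm : 0 < m) :
    alphaConst m = (m : ℝ) / (m + 1) *
      (((m : ℝ) + 1) * (Real.pi / 4) *
        (Real.Gamma (((m : ℝ) + 1) / 2) / Real.Gamma (((m : ℝ) + 2) / 2)) ^ 2) ^
          (1 / (m : ℝ)) := by
  have hm1 : (0 : ℝ) < (m : ℝ) + 1 := by positivity
  have hG := Real.Gamma_pos_of_pos (show (0 : ℝ) < ((m : ℝ) + 1) / 2 by positivity)
  have hG' := Real.Gamma_pos_of_pos (show (0 : ℝ) < ((m : ℝ) + 2) / 2 by positivity)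
  have hpi := Real.pi_pos
  rw [alphaConst, Real.mul_rpow (by positivity) (by positivity),
    Real.mul_rpow (by positivity) (by positivity), Real.rpow_sub hm1, Real.rpow_one,
    ← Real.rpow_natCast_mul (by positivity),
    show ((2 : ℕ) : ℝ) * (1 / (m : ℝ)) = 2 / m by push_cast; ring]
  have := Real.rpow_pos_of_pos hm1 (1 / (m : ℝ))
  field_simp

theorem div_add_one_le_alphaConst {m : ℕ} (hm : 0 < m) :
    (m : ℝ) / (m + 1) ≤ alphaConst m := by
  rw [alphaConst_eq hm]
  refine le_mul_of_one_le_right (by positivity) (Real.one_le_rpow ?_ (by positivity))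
  have hx : (0 : ℝ) < ((m : ℝ) + 1) / 2 := by positivity
  have hG := Real.Gamma_pos_of_pos (show (0 : ℝ) < ((m : ℝ) + 2) / 2 by positivity)
  have h := Gamma_add_half_sq_le hx
  rw [show ((m : ℝ) + 1) / 2 + 1 / 2 = ((m : ℝ) + 2) / 2 by ring] at h
  rw [div_pow, ← mul_div_assoc, one_le_div (by positivity)]
  refine h.trans (mul_le_mul_of_nonneg_right ?_ (sq_nonneg _))
  nlinarith [Real.pi_gt_three]

/-- The paper's constant for cylinders in `ℝ^{n+1}` strictly improves the
Berezin–Li–Yau constant: `β_{n+1} < α_{n+1}`. -/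
theorem beta_lt_alpha (n : ℕ) (hn : 2 ≤ n) : betaConst (n + 1) < alphaConst (n + 1) := by
  refine lt_of_lt_of_le ?_ (div_add_one_le_alphaConst n.succ_pos)
  exact div_lt_div_of_pos_left (by positivity) (by positivity) (by linarith)
end
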